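/- For every n ≥ 1 and every f ∈ Δ, the element q_n·(q_{n+1}^*(f)) lies in 8Δ. -/

import Mathlib

open MvPolynomial

noncomputable section

/-- `R = ℚ[p₁,p₃,p₅,…]`: the variable `X k` represents `p_{2k+1}`. -/
abbrev FockR : Type := MvPolynomial ℕ ℚ

/-- `Δ = ℤ₍₂₎[p₁, 2p₃, 4p₅, …]`: the smallest subring of `R` containing all constants
with odd denominator (i.e. the image of `ℤ₍₂₎`) and the elements `2^k p_{2k+1}`. -/
def Delta : Subring FockR :=
  Subring.closure ({f | ∃ q : ℚ, Odd q.den ∧ f = C q} ∪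
    {f | ∃ k : ℕ, f = (2 : FockR) ^ k * X k})

/-- `z_μ` (as a rational) for the partition with odd parts corresponding to the
exponent vector `d` (where `d k` is the multiplicity of the part `2k+1`). -/
def zExp (d : ℕ →₀ ℕ) : ℚ :=
  ∏ k ∈ d.support, ((2 * k + 1 : ℚ) ^ d k * (Nat.factorial (d k)))

/-- The bilinear form on `R` for which the monomials `p_μ` are orthogonal with
`⟨p_μ, p_μ⟩ = z_μ`. -/
def innerP (f g : FockR) : ℚ :=
  ∑ d ∈ f.support, coeff d f * coeff d g * zExp d

/-- The exponent vector of `p_μ`: part `p = 2k+1` of `μ` contributes to the variable `X k`. -/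
def toExp {n : ℕ} (μ : Nat.Partition n) : ℕ →₀ ℕ :=
  (μ.parts.map (fun p => Finsupp.single ((p - 1) / 2) 1)).sum

/-- `p_μ` as an element of `R`. -/
def pMu {n : ℕ} (μ : Nat.Partition n) : FockR := monomial (toExp μ) 1

/-- `z_μ` for a partition `μ`. -/
def zPart {n : ℕ} (μ : Nat.Partition n) : ℚ :=
  (μ.parts.dedup.map
    (fun k => (k : ℚ) ^ μ.parts.count k * (Nat.factorial (μ.parts.count k)))).prod

/-- `q_n = Σ_{μ ⊢ n, odd parts} (2^{ℓ(μ)}/z_μ) p_μ`. -/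
def qFun (n : ℕ) : FockR :=
  ∑ μ ∈ Nat.Partition.odds n, ((2 : ℚ) ^ (Multiset.card μ.parts) / zPart μ) • pMu μ

/-- The operator `p_μ^*` (composite of the `k·∂/∂p_k`), for a partition with exponent
vector `e`, given by its action on coefficients. -/
def pStar (e : ℕ →₀ ℕ) (f : FockR) : FockR :=
  ∑ d ∈ f.support,
    (coeff d f * ∏ k ∈ e.support, ((2 * k + 1 : ℚ) ^ e k * ((d k).descFactorial (e k)))) •
      monomial (d - e) (1 : ℚ)

/-- `q_n^* = Σ_{μ ⊢ n, odd parts} (2^{ℓ(μ)}/z_μ) p_μ^*`. -/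
def qStar (n : ℕ) (f : FockR) : FockR :=
  ∑ μ ∈ Nat.Partition.odds n, ((2 : ℚ) ^ (Multiset.card μ.parts) / zPart μ) • pStar (toExp μ) f

/-- `ε(n)`: 0 if `n` even, 1 if `n` odd. -/
def eps (n : ℕ) : ℕ := n % 2

/-- `a(n)`: the largest integer `m` with `m(m+1)/2 ≤ n`. -/
def aFun (n : ℕ) : ℕ := Nat.findGreatest (fun m => m * (m + 1) ≤ 2 * n) n

/-- rationals with odd denominator -/
def Z2 : Subring ℚ where
  carrier := {q | Odd q.den}
  mul_mem' {a b} ha hb := Odd.of_dvd_nat (Odd.mul ha hb) (Rat.mul_den_dvd a b)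
  one_mem' := by simp
  add_mem' {a b} ha hb := Odd.of_dvd_nat (Odd.mul ha hb) (Rat.add_den_dvd a b)
  zero_mem' := by simp
  neg_mem' {a} ha := by simpa using ha

lemma Z2_iff (q : ℚ) : q ∈ Z2 ↔ Odd q.den := Iff.rfl

lemma Z2_inv_odd (n : ℕ) (h : Odd n) : ((n : ℚ))⁻¹ ∈ Z2 := by
  rw [Z2_iff]
  rw [Rat.inv_natCast_den]
  split_ifs <;> simp_all

lemma Z2_fact (a : ℕ) (ha : a ≠ 0) : (2 : ℚ) ^ (a - 1) / (Nat.factorial a : ℚ) ∈ Z2 := by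
  obtain ⟨v, m, hm, h⟩ := Nat.exists_eq_two_pow_mul_odd (Nat.factorial_ne_zero a)
  have h1 := Nat.emultiplicity_two_factorial_lt ha
  have h2 : v < a := by
    by_contra hc
    push Not at hc
    have : 2 ^ a ∣ a.factorial := by
      rw [h]; exact Dvd.dvd.mul_right (pow_dvd_pow 2 hc) m
    have := le_emultiplicity_of_pow_dvd this
    exact absurd h1 (not_lt.mpr this)
  have : (2 : ℚ) ^ (a - 1) / (Nat.factorial a : ℚ) = ((2 ^ (a - 1 - v) : ℕ) : ℚ) * (m : ℚ)⁻¹ := by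
    rw [h]
    have hm0 : (m : ℚ) ≠ 0 := by
      have := hm.pos
      positivity
    have : a - 1 = v + (a - 1 - v) := by omega
    conv_lhs => rw [this]
    push_cast
    rw [pow_add]
    field_simp
  rw [this]
  exact Z2.mul_mem (natCast_mem Z2 _) (Z2_inv_odd m hm)

/-- weight -/
def wt (d : ℕ →₀ ℕ) : ℕ := d.sum (fun k a => k * a)
/-- length -/
def len (d : ℕ →₀ ℕ) : ℕ := d.sum (fun _ a => a)

lemma wt_add (d e : ℕ →₀ ℕ) : wt (d + e) = wt d + wt e :=
  Finsupp.sum_add_index' (by simp) (by intros; ring)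

lemma len_add (d e : ℕ →₀ ℕ) : len (d + e) = len d + len e :=
  Finsupp.sum_add_index' (by simp) (by intros; ring)

lemma wt_single (k a : ℕ) : wt (Finsupp.single k a) = k * a := by
  simp [wt]

lemma len_single (k a : ℕ) : len (Finsupp.single k a) = a := by
  simp [len]

lemma fact_half (d : ℕ →₀ ℕ) (hd : d ≠ 0) : (2 : ℚ) ^ (len d - 1) / zExp d ∈ Z2 := by
  have h1 : ∏ k ∈ d.support, ((2 : ℚ) ^ (d k - 1) / ((2 * k + 1 : ℚ) ^ d k * (Nat.factorial (d k))))
      ∈ Z2 := by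
    apply Z2.prod_mem
    intro k hk
    have hk' : d k ≠ 0 := by simpa using hk
    have := Z2.mul_mem (Z2_fact (d k) hk') (Z2_inv_odd ((2 * k + 1) ^ d k) (Odd.pow ⟨k, rfl⟩))
    convert this using 1
    push_cast
    field_simp
  have h2 : len d = ∑ k ∈ d.support, (d k - 1) + d.support.card := by
    rw [Finset.card_eq_sum_ones, ← Finset.sum_add_distrib]
    refine Finset.sum_congr rfl fun k hk => ?_
    have hk' : d k ≠ 0 := by simpa using hk
    show d k = d k - 1 + 1
    omega
  have h3 : 0 < d.support.card := by
    rw [Finset.card_pos]; exact Finsupp.support_nonempty_iff.mpr hd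
  have h4 : len d - 1 = (d.support.card - 1) + ∑ k ∈ d.support, (d k - 1) := by omega
  rw [h4, pow_add, zExp, mul_div_assoc, ← Finset.prod_pow_eq_pow_sum, ← Finset.prod_div_distrib]
  refine Z2.mul_mem ?_ h1
  exact Z2.pow_mem (natCast_mem Z2 2) _

lemma C_two_eq : (C 2 : FockR) = 2 := map_ofNat C 2

lemma Delta_coeff (f : FockR) (hf : f ∈ Delta) : ∀ d, ∃ c ∈ Z2, coeff d f = 2 ^ wt d * c := by
  induction hf using Subring.closure_induction with
  | mem x hx =>
    rcases hx with ⟨q, hq, rfl⟩ | ⟨k, rfl⟩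
    · intro d
      rw [coeff_C]
      split_ifs with h
      · subst h
        exact ⟨q, hq, by simp [wt]⟩
      · exact ⟨0, Z2.zero_mem, by simp⟩
    · intro d
      have : (2 : FockR) ^ k * X k = monomial (Finsupp.single k 1) ((2 : ℚ) ^ k) := by
        rw [← mul_one ((2 : ℚ) ^ k), ← C_mul_monomial]
        simp [X, C_two_eq]
      rw [this, coeff_monomial]
      split_ifs with h
      · subst h
        exact ⟨1, Z2.one_mem, by simp [wt_single]⟩
      · exact ⟨0, Z2.zero_mem, by simp⟩
  | zero => exact fun d => ⟨0, Z2.zero_mem, by simp⟩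
  | one =>
    intro d
    rw [coeff_one]
    split_ifs with h
    · subst h
      exact ⟨1, Z2.one_mem, by simp [wt]⟩
    · exact ⟨0, Z2.zero_mem, by simp⟩
  | add x y _ _ hx hy =>
    intro d
    obtain ⟨a, ha, h1⟩ := hx d
    obtain ⟨b, hb, h2⟩ := hy d
    exact ⟨a + b, Z2.add_mem ha hb, by rw [coeff_add, h1, h2]; ring⟩
  | neg x _ hx =>
    intro d
    obtain ⟨a, ha, h1⟩ := hx d
    exact ⟨-a, Z2.neg_mem ha, by rw [coeff_neg, h1]; ring⟩
  | mul x y _ _ hx hy =>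
    intro d
    choose a ha h1 using hx
    choose b hb h2 using hy
    refine ⟨∑ p ∈ Finset.HasAntidiagonal.antidiagonal d, a p.1 * b p.2,
      Z2.sum_mem fun p _ => Z2.mul_mem (ha _) (hb _), ?_⟩
    rw [coeff_mul, Finset.mul_sum]
    refine Finset.sum_congr rfl fun p hp => ?_
    rw [Finset.HasAntidiagonal.mem_antidiagonal] at hp
    rw [h1, h2, ← hp, wt_add, pow_add]
    ring

lemma mono_Delta (d : ℕ →₀ ℕ) : monomial d ((2 : ℚ) ^ wt d) ∈ Delta := by
  induction d using Finsupp.induction_linear with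
  | zero => simp [wt]
  | add d e hd he =>
    rw [wt_add, pow_add, ← monomial_mul]
    exact Delta.mul_mem hd he
  | single k a =>
    have h : (2 : FockR) ^ k * X k ∈ Delta := Subring.subset_closure (Or.inr ⟨k, rfl⟩)
    have := Delta.pow_mem h a
    convert this using 1
    rw [mul_pow, X_pow_eq_monomial, wt_single, ← mul_one ((2 : ℚ) ^ (k * a)), ← C_mul_monomial,
      pow_mul]
    simp [C_two_eq]

lemma mono_Delta' (d : ℕ →₀ ℕ) (c : ℚ) (hc : c ∈ Z2) : monomial d ((2 : ℚ) ^ wt d * c) ∈ Delta := by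
  rw [mul_comm, ← C_mul_monomial]
  exact Delta.mul_mem (Subring.subset_closure (Or.inl ⟨c, hc, rfl⟩)) (mono_Delta d)

/-- exponents of a multiset -/
def mexp (s : Multiset ℕ) : ℕ →₀ ℕ := (s.map (fun p => Finsupp.single ((p - 1) / 2) 1)).sum

lemma mexp_prop (s : Multiset ℕ) (hs : ∀ p ∈ s, Odd p) :
    len (mexp s) = Multiset.card s ∧ 2 * wt (mexp s) + Multiset.card s = s.sum ∧
      ∀ k, mexp s k = s.count (2 * k + 1) := by
  induction s using Multiset.induction with
  | empty => simp [mexp, len, wt]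
  | cons a s ih =>
    obtain ⟨h1, h2, h3⟩ := ih (fun p hp => hs p (Multiset.mem_cons_of_mem hp))
    obtain ⟨j, hj⟩ := hs a (Multiset.mem_cons_self a s)
    have hm : mexp (a ::ₘ s) = Finsupp.single j 1 + mexp s := by
      have : (a - 1) / 2 = j := by omega
      simp [mexp, this]
    rw [hm, len_add, wt_add, len_single, wt_single, Multiset.card_cons, Multiset.sum_cons]
    refine ⟨by omega, by omega, fun k => ?_⟩
    rw [Finsupp.add_apply, h3, Multiset.count_cons, Finsupp.single_apply, hj]
    by_cases h : j = k
    · simp [h]; ring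
    · have : ¬ (2 * k + 1 = 2 * j + 1) := by omega
      simp [h]; omega

lemma odds_iff {n : ℕ} (μ : Nat.Partition n) (h : μ ∈ Nat.Partition.odds n) :
    ∀ p ∈ μ.parts, Odd p := by
  intro p hp
  have : ¬ Even p := (Finset.mem_filter.mp h).2 p hp
  rwa [Nat.not_even_iff_odd] at this

lemma toExp_prop {n : ℕ} (μ : Nat.Partition n) (h : μ ∈ Nat.Partition.odds n) :
    len (toExp μ) = Multiset.card μ.parts ∧ 2 * wt (toExp μ) + len (toExp μ) = n ∧
      zPart μ = zExp (toExp μ) := by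
  have ho := odds_iff μ h
  obtain ⟨h1, h2, h3⟩ := mexp_prop μ.parts ho
  change len (toExp μ) = _ at h1
  change 2 * wt (toExp μ) + _ = _ at h2
  change ∀ k, toExp μ k = _ at h3
  refine ⟨h1, by rw [h1, h2, μ.parts_sum], ?_⟩
  have : zPart μ = ∏ p ∈ μ.parts.toFinset,
      ((p : ℚ) ^ μ.parts.count p * (Nat.factorial (μ.parts.count p))) := by
    have hc : ∀ i : ℕ, Multiset.count (i : ℚ) (Multiset.map Nat.cast μ.parts)
        = Multiset.count i μ.parts := fun i =>
      Multiset.count_map_eq_count' _ _ Nat.cast_injective i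
    simp [zPart, Finset.prod, hc]
  rw [this, zExp]
  symm
  refine Finset.prod_nbij' (fun k => 2 * k + 1) (fun p => (p - 1) / 2) ?_ ?_ ?_ ?_ ?_
  · intro k hk
    rw [Finsupp.mem_support_iff, h3] at hk
    simpa using hk
  · intro p hp
    rw [Multiset.mem_toFinset] at hp
    obtain ⟨j, hj⟩ := ho p hp
    rw [Finsupp.mem_support_iff, h3]
    have : 2 * ((p - 1) / 2) + 1 = p := by omega
    rw [this]
    simpa using hp
  · intro k hk
    show (2 * k + 1 - 1) / 2 = k
    omega
  · intro p hp
    rw [Multiset.mem_toFinset] at hp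
    obtain ⟨j, hj⟩ := ho p hp
    show 2 * ((p - 1) / 2) + 1 = p
    omega
  · intro k hk
    simp [h3]

lemma zExp_ne (e : ℕ →₀ ℕ) : zExp e ≠ 0 := by
  rw [zExp, Finset.prod_ne_zero_iff]
  intro k _
  positivity

lemma desc_prod (d e : ℕ →₀ ℕ) :
    ∏ k ∈ e.support, ((2 * k + 1 : ℚ) ^ e k * ((d k).descFactorial (e k)))
      = zExp e * ((∏ k ∈ e.support, (d k).choose (e k) : ℕ) : ℚ) := by
  rw [zExp, Nat.cast_prod, ← Finset.prod_mul_distrib]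
  refine Finset.prod_congr rfl fun k _ => ?_
  rw [Nat.descFactorial_eq_factorial_mul_choose]
  push_cast
  ring

lemma key (m e d : ℕ →₀ ℕ) (n : ℕ) (hm : 2 * wt m + len m = n) (he : 2 * wt e + len e = n + 1)
    (hn : 1 ≤ n) (c : ℚ) (hc : c ∈ Z2) :
    ∃ b ∈ Z2, 2 ^ len m / zExp m * (2 ^ len e / zExp e * (2 ^ wt d * c *
      ∏ k ∈ e.support, ((2 * k + 1 : ℚ) ^ e k * ((d k).descFactorial (e k)))))
      = 8 * (2 ^ wt (m + (d - e)) * b) := by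
  rw [desc_prod]
  have lenpos : ∀ x : ℕ →₀ ℕ, len x = 0 → x = 0 := by
    intro x hx
    ext k
    by_contra hk
    have hk' : k ∈ x.support := by simpa using hk
    have : ∑ k ∈ x.support, x k = 0 := hx
    exact hk (Finset.sum_eq_zero_iff.mp this k hk')
  by_cases hle : e ≤ d
  · have hm0 : m ≠ 0 := by
      rintro rfl
      simp [wt, len] at hm
      omega
    have he0 : e ≠ 0 := by
      rintro rfl
      simp [wt, len] at he
    have hml : len m ≠ 0 := fun h => hm0 (lenpos m h)
    have hel : len e ≠ 0 := fun h => he0 (lenpos e h)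
    have hd : wt d = wt (d - e) + wt e := by rw [← wt_add, tsub_add_cancel_of_le hle]
    obtain ⟨t, ht⟩ : ∃ t, len e + wt e = wt m + 2 + t := ⟨len e + wt e - (wt m + 2), by omega⟩
    obtain ⟨l, hl⟩ : ∃ l, len m = l + 1 := ⟨len m - 1, by omega⟩
    have hf := fact_half m hm0
    rw [hl, Nat.add_sub_cancel] at hf
    refine ⟨2 ^ t * (2 ^ l / zExp m) * (∏ k ∈ e.support, (d k).choose (e k) : ℕ) * c,
      Z2.mul_mem (Z2.mul_mem (Z2.mul_mem (Z2.pow_mem (natCast_mem Z2 2) _) hf)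
        (natCast_mem Z2 _)) hc, ?_⟩
    have h2 : (2 : ℚ) ^ len e * 2 ^ wt e = 2 ^ wt m * 4 * 2 ^ t := by
      rw [← pow_add, ht, pow_add, pow_add]; norm_num
    have z1 := zExp_ne e
    have z2 := zExp_ne m
    rw [hl, hd, wt_add]
    generalize ((∏ k ∈ e.support, (d k).choose (e k) : ℕ) : ℚ) = P
    field_simp
    rw [pow_add, pow_add, pow_add]
    linear_combination (2 ^ l * 2 * 2 ^ wt (d - e) * P * c) * h2
  · refine ⟨0, Z2.zero_mem, ?_⟩
    have : ∃ k, ¬ e k ≤ d k := by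
      by_contra h
      push Not at h
      exact hle h
    obtain ⟨k, hk⟩ := this
    have : ∏ k ∈ e.support, (d k).choose (e k) = 0 := by
      refine Finset.prod_eq_zero (i := k) ?_ (Nat.choose_eq_zero_of_lt (by omega))
      rw [Finsupp.mem_support_iff]
      omega
    rw [this]
    simp

/-- For every `n ≥ 1` and `f ∈ Δ`, the element `q_n·(q_{n+1}^*(f))` lies in `8Δ`. -/
theorem qn_mul_qstarsucc_maps_Delta (n : ℕ) (hn : 1 ≤ n) (f : FockR) (hf : f ∈ Delta) :
    ∃ g ∈ Delta, qFun n * qStar (n + 1) f = 8 * g := by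
  have hsum : ∀ {ι : Type} (s : Finset ι) (F : ι → FockR),
      (∀ i ∈ s, ∃ g ∈ Delta, F i = 8 * g) → ∃ g ∈ Delta, ∑ i ∈ s, F i = 8 * g := by
    intro ι s F h
    choose! g hg h2 using h
    exact ⟨∑ i ∈ s, g i, Delta.sum_mem hg, by rw [Finset.mul_sum]; exact Finset.sum_congr rfl h2⟩
  rw [qFun, qStar, Finset.sum_mul]
  refine hsum _ _ fun μ hμ => ?_
  rw [Finset.mul_sum]
  refine hsum _ _ fun ν hν => ?_
  rw [pStar, Finset.smul_sum, Finset.mul_sum]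
  refine hsum _ _ fun d _ => ?_
  obtain ⟨hm1, hm2, hm3⟩ := toExp_prop μ hμ
  obtain ⟨he1, he2, he3⟩ := toExp_prop ν hν
  obtain ⟨c, hc, hcd⟩ := Delta_coeff f hf d
  obtain ⟨b, hb, hkey⟩ := key (toExp μ) (toExp ν) d n hm2 he2 hn c hc
  refine ⟨_, mono_Delta' (toExp μ + (d - toExp ν)) b hb, ?_⟩
  rw [pMu, hm3, he3, ← hm1, ← he1, hcd]
  have h8 : (8 : FockR) = C 8 := (map_ofNat C 8).symm
  rw [h8, C_mul_monomial, ← hkey]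
  simp only [smul_monomial, monomial_mul, smul_eq_mul, mul_one]

end
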